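/- Let (A_k, f_k : A_{k+1} → A_k) and (B_k, g_k : B_{k+1} → B_k) be inverse systems of finitely generated abelian groups indexed by the positive integers. Suppose that for every prime number p there is a family of group isomorphisms φ_{k,p} : A_k ⊗_ℤ ℤ_p → B_k ⊗_ℤ ℤ_p commuting with the transition maps, i.e. φ_{k,p} ∘ (f_k ⊗ id) = (g_k ⊗ id) ∘ φ_{k+1,p} for all k. If the system (A_k) satisfies the Mittag-Leffler condition, then the system (B_k) also satisfies the Mittag-Leffler condition. -/

import Mathlib

/-- An inverse system `(G, f)` of abelian groups indexed by `ℕ`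
(with composite transition maps `f i j : G j →+ G i` for `i ≤ j`) satisfies
the **Mittag-Leffler condition** if for every index `i` there is a `j > i`
such that for every `k > j` the image of `G k → G i` equals the image of
`G j → G i`. -/
def MittagLefflerCondition (G : ℕ → Type*) [∀ k, AddCommGroup (G k)]
    (f : ∀ i j, i ≤ j → (G j →+ G i)) : Prop :=
  ∀ i, ∃ j, ∃ hij : i < j, ∀ k, ∀ hjk : j < k,
    (f i k (hij.le.trans hjk.le)).range = (f i j hij.le).range

open TensorProduct in
/-- If `x ⊗ 1 = 0` in `M ⊗ ℤ_[p]`, then `x` is divisible by every power of `p`. -/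
theorem mem_span_pow_smul_top_of_tmul_padicInt_one_eq_zero {M : Type*} [AddCommGroup M]
    (p : ℕ) [Fact p.Prime] (x : M) (hx : x ⊗ₜ[ℤ] (1 : ℤ_[p]) = 0) (n : ℕ) :
    x ∈ (Ideal.span {(p : ℤ)} ^ n • ⊤ : Submodule ℤ M) := by
  let e : ℤ_[p] →+* ℤ ⧸ Ideal.span {((p ^ n : ℕ) : ℤ)} :=
    (Int.quotientSpanNatEquivZMod (p ^ n)).symm.toRingHom.comp (PadicInt.toZModPow n)
  have h := congrArg (LinearMap.lTensor M e.toAddMonoidHom.toIntLinearMap) hx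
  have he : e.toAddMonoidHom.toIntLinearMap (1 : ℤ_[p]) = 1 := map_one e
  rw [LinearMap.lTensor_tmul, he, map_zero] at h
  have h' := congrArg (tensorQuotEquivQuotSMul M (Ideal.span {((p ^ n : ℕ) : ℤ)})) h
  rw [map_zero, ← map_one (Ideal.Quotient.mk _), tensorQuotEquivQuotSMul_tmul_mk, one_smul,
    Submodule.Quotient.mk_eq_zero] at h'
  rw [Ideal.span_singleton_pow]
  exact_mod_cast h'

open TensorProduct in
/-- An element of a finitely generated abelian group vanishes if it does so after tensoring
with `ℤ_[p]` for every prime `p`. -/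
theorem eq_zero_of_forall_tmul_padicInt_one_eq_zero {M : Type*} [AddCommGroup M]
    [Module.Finite ℤ M] (x : M)
    (hx : ∀ (p : ℕ) [Fact p.Prime], x ⊗ₜ[ℤ] (1 : ℤ_[p]) = 0) : x = 0 := by
  by_contra hne
  let I : Ideal ℤ := LinearMap.ker (LinearMap.toSpanSingleton ℤ M x)
  have hd : (Submodule.IsPrincipal.generator I).natAbs ≠ 1 := by
    intro h
    have hu : IsUnit (Submodule.IsPrincipal.generator I) := Int.isUnit_iff_natAbs_eq.2 h
    have h1 : (1 : ℤ) ∈ I := by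
      rw [Ideal.eq_top_of_isUnit_mem I (Submodule.IsPrincipal.generator_mem I) hu]
      trivial
    exact hne (by simpa [I] using h1)
  obtain ⟨p, hp, hpd⟩ := Nat.exists_prime_and_dvd hd
  have : Fact p.Prime := ⟨hp⟩
  have hmem : x ∈ (⨅ n : ℕ, Ideal.span {(p : ℤ)} ^ n • ⊤ : Submodule ℤ M) :=
    Submodule.mem_iInf _ |>.2
      (mem_span_pow_smul_top_of_tmul_padicInt_one_eq_zero p x (hx p))
  obtain ⟨⟨r, hr⟩, hrx⟩ := (Ideal.mem_iInf_smul_pow_eq_bot_iff _ x).1 hmem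
  have hrI : 1 - r ∈ I := by
    simpa [I, sub_smul, sub_eq_zero] using hrx.symm
  have h1 : (p : ℤ) ∣ 1 - r := (Int.natCast_dvd.2 hpd).trans
    ((Submodule.IsPrincipal.mem_iff_generator_dvd I).1 hrI)
  have h2 : (p : ℤ) ∣ 1 := by
    simpa using dvd_add h1 (Ideal.mem_span_singleton.1 hr)
  exact hp.one_lt.ne' (by exact_mod_cast Int.eq_one_of_dvd_one (by positivity) h2)

open TensorProduct in
/-- Membership of an element of a finitely generated abelian group in the range of a
homomorphism can be checked after tensoring with `ℤ_[p]` for every prime `p`. -/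
theorem mem_range_of_forall_tmul_padicInt_one_mem_range {M N : Type*} [AddCommGroup M]
    [AddCommGroup N] [Module.Finite ℤ M] (f : N →ₗ[ℤ] M) (x : M)
    (hx : ∀ (p : ℕ) [Fact p.Prime],
      x ⊗ₜ[ℤ] (1 : ℤ_[p]) ∈ LinearMap.range (LinearMap.rTensor ℤ_[p] f)) :
    x ∈ LinearMap.range f := by
  rw [← Submodule.Quotient.mk_eq_zero]
  refine eq_zero_of_forall_tmul_padicInt_one_eq_zero _ fun p _ ↦ ?_
  obtain ⟨y, hy⟩ := hx p
  have h := congrArg (LinearMap.rTensor ℤ_[p] (LinearMap.range f).mkQ) hy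
  rw [← LinearMap.comp_apply, ← LinearMap.rTensor_comp, LinearMap.range_mkQ_comp,
    LinearMap.rTensor_zero, LinearMap.zero_apply, LinearMap.rTensor_tmul] at h
  exact h.symm

/-- A family of maps between tensored inverse systems that commutes with the one-step transition
maps commutes with all transition maps. -/
theorem rTensor_comm_of_rTensor_succ_comm {A B : ℕ → Type*} [∀ k, AddCommGroup (A k)]
    [∀ k, AddCommGroup (B k)] {R : Type*} [AddCommGroup R]
    {fA : ∀ i j, i ≤ j → (A j →+ A i)} {fB : ∀ i j, i ≤ j → (B j →+ B i)}
    (hfA_id : ∀ i, fA i i le_rfl = AddMonoidHom.id (A i))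
    (hfB_id : ∀ i, fB i i le_rfl = AddMonoidHom.id (B i))
    (hfA_comp : ∀ i j k (hij : i ≤ j) (hjk : j ≤ k),
      (fA i j hij).comp (fA j k hjk) = fA i k (hij.trans hjk))
    (hfB_comp : ∀ i j k (hij : i ≤ j) (hjk : j ≤ k),
      (fB i j hij).comp (fB j k hjk) = fB i k (hij.trans hjk))
    (φ : ∀ k, TensorProduct ℤ (A k) R → TensorProduct ℤ (B k) R)
    (hφ : ∀ k (x : TensorProduct ℤ (A (k + 1)) R),
      φ k (LinearMap.rTensor R (fA k (k + 1) (Nat.le_succ k)).toIntLinearMap x) =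
        LinearMap.rTensor R (fB k (k + 1) (Nat.le_succ k)).toIntLinearMap (φ (k + 1) x))
    (i j : ℕ) (hij : i ≤ j) (x : TensorProduct ℤ (A j) R) :
    φ i (LinearMap.rTensor R (fA i j hij).toIntLinearMap x) =
      LinearMap.rTensor R (fB i j hij).toIntLinearMap (φ j x) := by
  induction j, hij using Nat.le_induction with
  | base =>
    have hA : (fA i i le_rfl).toIntLinearMap = LinearMap.id := by rw [hfA_id]; rfl
    have hB : (fB i i le_rfl).toIntLinearMap = LinearMap.id := by rw [hfB_id]; rfl
    simp [hA, hB]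
  | succ j hij ih =>
    have hA : (fA i (j + 1) (hij.trans j.le_succ)).toIntLinearMap =
        (fA i j hij).toIntLinearMap ∘ₗ (fA j (j + 1) j.le_succ).toIntLinearMap := by
      rw [← hfA_comp i j (j + 1) hij j.le_succ]; rfl
    have hB : (fB i (j + 1) (hij.trans j.le_succ)).toIntLinearMap =
        (fB i j hij).toIntLinearMap ∘ₗ (fB j (j + 1) j.le_succ).toIntLinearMap := by
      rw [← hfB_comp i j (j + 1) hij j.le_succ]; rfl
    rw [hA, hB, LinearMap.rTensor_comp_apply, LinearMap.rTensor_comp_apply, ih, hφ]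

open TensorProduct in
/-- Tensoring preserves containment between the ranges of two homomorphisms. -/
theorem range_rTensor_le_of_range_le {M N P R : Type*} [AddCommGroup M] [AddCommGroup N]
    [AddCommGroup P] [AddCommGroup R] (f : M →ₗ[ℤ] P) (g : N →ₗ[ℤ] P)
    (h : LinearMap.range f ≤ LinearMap.range g) :
    LinearMap.range (LinearMap.rTensor R f) ≤ LinearMap.range (LinearMap.rTensor R g) := by
  rintro _ ⟨x, rfl⟩
  induction x using TensorProduct.induction_on with
  | zero => simp
  | tmul m r =>
    obtain ⟨n, hn⟩ := h ⟨m, rfl⟩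
    exact ⟨n ⊗ₜ r, by simp [hn]⟩
  | add x y hx hy => rw [map_add]; exact add_mem hx hy

/-- central algebraic step in the proof of Theorem 2.4 of
the paper.  Let `(A, fA)` and `(B, fB)` be inverse systems of finitely
generated abelian groups indexed by `ℕ`.  Suppose that for every prime `p`
there is a family of group isomorphisms
`φ k : A k ⊗_ℤ ℤ_p ≃+ B k ⊗_ℤ ℤ_p` commuting with the (tensored) transition
maps.  If `(A, fA)` satisfies the Mittag-Leffler condition, then so does
`(B, fB)`. -/
theorem mittagLeffler_of_tensor_padic_iso
    (A B : ℕ → Type*) [∀ k, AddCommGroup (A k)] [∀ k, AddCommGroup (B k)]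
    (hA : ∀ k, AddGroup.FG (A k)) (hB : ∀ k, AddGroup.FG (B k))
    (fA : ∀ i j, i ≤ j → (A j →+ A i)) (fB : ∀ i j, i ≤ j → (B j →+ B i))
    (hfA_id : ∀ i, fA i i le_rfl = AddMonoidHom.id (A i))
    (hfB_id : ∀ i, fB i i le_rfl = AddMonoidHom.id (B i))
    (hfA_comp : ∀ i j k (hij : i ≤ j) (hjk : j ≤ k),
      (fA i j hij).comp (fA j k hjk) = fA i k (hij.trans hjk))
    (hfB_comp : ∀ i j k (hij : i ≤ j) (hjk : j ≤ k),
      (fB i j hij).comp (fB j k hjk) = fB i k (hij.trans hjk))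
    (hiso : ∀ (p : ℕ) [Fact p.Prime],
      ∃ φ : ∀ k, TensorProduct ℤ (A k) ℤ_[p] ≃+ TensorProduct ℤ (B k) ℤ_[p],
        ∀ k (x : TensorProduct ℤ (A (k + 1)) ℤ_[p]),
          φ k (LinearMap.rTensor ℤ_[p]
            (fA k (k + 1) (Nat.le_succ k)).toIntLinearMap x) =
          LinearMap.rTensor ℤ_[p]
            (fB k (k + 1) (Nat.le_succ k)).toIntLinearMap (φ (k + 1) x))
    (hML : MittagLefflerCondition A fA) :
    MittagLefflerCondition B fB := by
  intro i
  obtain ⟨j, hij, hj⟩ := hML i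
  refine ⟨j, hij, fun k hjk ↦ le_antisymm ?_ ?_⟩
  · rintro _ ⟨b, rfl⟩
    exact ⟨fB j k hjk.le b, DFunLike.congr_fun (hfB_comp i j k hij.le hjk.le) b⟩
  · rintro _ ⟨b, rfl⟩
    have : Module.Finite ℤ (B i) := Module.Finite.iff_addGroup_fg.2 (hB i)
    refine mem_range_of_forall_tmul_padicInt_one_mem_range
      (fB i k (hij.le.trans hjk.le)).toIntLinearMap _ fun p _ ↦ ?_
    obtain ⟨φ, hφ⟩ := hiso p
    have hcomm := rTensor_comm_of_rTensor_succ_comm hfA_id hfB_id hfA_comp hfB_comp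
      (fun k ↦ φ k) hφ
    have hle : LinearMap.range (fA i j hij.le).toIntLinearMap ≤
        LinearMap.range (fA i k (hij.le.trans hjk.le)).toIntLinearMap :=
      fun x hx ↦ (hj k hjk).ge hx
    obtain ⟨a, ha⟩ := (φ j).surjective (TensorProduct.tmul ℤ b (1 : ℤ_[p]))
    obtain ⟨a', ha'⟩ := range_rTensor_le_of_range_le (R := ℤ_[p]) _ _ hle ⟨a, rfl⟩
    refine ⟨φ k a', ?_⟩
    rw [← hcomm, ha', hcomm, ha, LinearMap.rTensor_tmul]
    rfl
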